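/- arXiv:1207.6572 — 2 statements merged into one kernel-verified Lean document; each statement's English description precedes it below -/
import Mathlib

section
/- Let A_1, …, A_m be irreducible nonnegative n×n matrices with μ(A_i) > 0 for all i, and set Â_i = A_i/μ(A_i). If the Kleene stars commute pairwise, Â_i* ⊗ Â_j* = Â_j* ⊗ Â_i* for all 1 ≤ i, j ≤ m, then there exists a positive vector x ∈ int(ℝ^n_+) with A_i⊗x ≤ μ(A_i)·x for all i = 1,…,m. -/
open Filter Relation

namespace MaxAlg

/-- Max-algebraic action of a matrix on a vector: `(A ⊗ x) i = max_j A i j * x j`. -/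
noncomputable def maxVec {n : ℕ} (A : Fin n → Fin n → ℝ) (x : Fin n → ℝ) : Fin n → ℝ :=
  fun i => ⨆ j, A i j * x j

/-- Max-algebraic matrix product: `(A ⊗ B) i k = max_j A i j * B j k`. -/
noncomputable def maxMul {n : ℕ} (A B : Fin n → Fin n → ℝ) : Fin n → Fin n → ℝ :=
  fun i k => ⨆ j, A i j * B j k

/-- The weight of the cycle determined by a list `[i₁, …, i_k]`,
namely `A i₁ i₂ * ⋯ * A i_{k-1} i_k * A i_k i₁`. -/
noncomputable def cycleProd {n : ℕ} (A : Fin n → Fin n → ℝ) (l : List (Fin n)) : ℝ :=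
  ((l.zip (l.rotate 1)).map fun p => A p.1 p.2).prod

/-- The maximal cycle geometric mean of `A`: the supremum over all cycles of distinct
nodes of the k-th root of the cycle weight. -/
noncomputable def mu {n : ℕ} (A : Fin n → Fin n → ℝ) : ℝ :=
  sSup {c | ∃ l : List (Fin n), l ≠ [] ∧ l.Nodup ∧ c = cycleProd A l ^ ((l.length : ℝ)⁻¹)}

/-- `C_{A,r}`: the positive vectors with `A ⊗ x ≤ r x`. -/
def Cset {n : ℕ} (A : Fin n → Fin n → ℝ) (r : ℝ) : Set (Fin n → ℝ) :=
  {x | (∀ i, 0 < x i) ∧ ∀ i, maxVec A x i ≤ r * x i}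

/-- A critical cycle: a cycle of distinct nodes attaining `mu A`. -/
def IsCriticalCycle {n : ℕ} (A : Fin n → Fin n → ℝ) (l : List (Fin n)) : Prop :=
  l ≠ [] ∧ l.Nodup ∧ cycleProd A l ^ ((l.length : ℝ)⁻¹) = mu A

/-- `(i,j) ∈ E^C(A)`: the edge `(i,j)` lies on some critical cycle. -/
def criticalEdge {n : ℕ} (A : Fin n → Fin n → ℝ) (i j : Fin n) : Prop :=
  ∃ l : List (Fin n), IsCriticalCycle A l ∧ (i, j) ∈ l.zip (l.rotate 1)

/-- `i ∈ N^C(A)`: the node `i` lies on some critical cycle. -/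
def criticalNode {n : ℕ} (A : Fin n → Fin n → ℝ) (i : Fin n) : Prop :=
  ∃ l : List (Fin n), IsCriticalCycle A l ∧ i ∈ l

/-- Irreducibility: the digraph of `A` (edge `(i,j)` iff `A i j > 0`) is strongly connected. -/
def Irred {n : ℕ} (A : Fin n → Fin n → ℝ) : Prop :=
  ∀ i j, Relation.ReflTransGen (fun a b => 0 < A a b) i j

/-- Max-algebraic product of a word of matrices from the family `A`. -/
noncomputable def wordProd {n m : ℕ} (A : Fin m → Fin n → Fin n → ℝ) :
    List (Fin m) → (Fin n → Fin n → ℝ)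
  | [] => fun i j => if i = j then 1 else 0
  | [j] => A j
  | j :: k :: w => maxMul (A j) (wordProd A (k :: w))

/-- The max version of the generalised spectral radius
`μ̂(Ψ) = limsup_{p→∞} (max_{ψ ∈ Ψ^p_⊗} μ(ψ))^{1/p}`. -/
noncomputable def genSpecRad {n m : ℕ} (A : Fin m → Fin n → Fin n → ℝ) : ℝ :=
  Filter.limsup
    (fun p : ℕ =>
      (sSup {c | ∃ w : List (Fin m), w.length = p ∧ c = mu (wordProd A w)}) ^ ((p : ℝ)⁻¹))
    Filter.atTop

/-- `S = A₁ ⊕ ⋯ ⊕ A_m`: the entrywise maximum of the family. -/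
noncomputable def Smat {n m : ℕ} (A : Fin m → Fin n → Fin n → ℝ) : Fin n → Fin n → ℝ :=
  fun i j => ⨆ k, A k i j

/-- The relative error function `e_A(x) = max_{i,j} A i j * x j / x i`. -/
noncomputable def errF {n : ℕ} (A : Fin n → Fin n → ℝ) (x : Fin n → ℝ) : ℝ :=
  ⨆ i, ⨆ j, A i j * x j / x i

/-- A symmetrically reciprocal (SR) matrix: positive, with unit diagonal and
`A i j * A j i = 1` for `i ≠ j`. -/
def IsSR {n : ℕ} (A : Fin n → Fin n → ℝ) : Prop :=
  (∀ i j, 0 < A i j) ∧ (∀ i, A i i = 1) ∧ ∀ i j, i ≠ j → A i j * A j i = 1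

/-- Max-algebraic matrix powers. -/
noncomputable def maxPow {n : ℕ} (B : Fin n → Fin n → ℝ) : ℕ → (Fin n → Fin n → ℝ)
  | 0 => fun i j => if i = j then 1 else 0
  | p + 1 => maxMul B (maxPow B p)

/-- The Kleene star `B* = I ⊕ B ⊕ B⊗² ⊕ ⋯ ⊕ B⊗^{n-1}`. -/
noncomputable def kleeneStar {n : ℕ} (B : Fin n → Fin n → ℝ) : Fin n → Fin n → ℝ :=
  fun i j => ⨆ p : Fin n, maxPow B p i j

section Products

variable {n : ℕ}

lemma le_maxVec (A : Fin n → Fin n → ℝ) (x : Fin n → ℝ) (i j : Fin n) :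
    A i j * x j ≤ maxVec A x i :=
  le_ciSup (f := fun j => A i j * x j) (Set.finite_range _).bddAbove j

lemma exists_maxVec_eq (A : Fin n → Fin n → ℝ) (x : Fin n → ℝ) (i : Fin n) :
    ∃ j, A i j * x j = maxVec A x i :=
  have : Nonempty (Fin n) := ⟨i⟩
  exists_eq_ciSup_of_finite

lemma le_maxMul (A B : Fin n → Fin n → ℝ) (i j k : Fin n) :
    A i j * B j k ≤ maxMul A B i k :=
  le_maxVec A (fun j => B j k) i j

lemma exists_maxMul_eq (A B : Fin n → Fin n → ℝ) (i k : Fin n) :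
    ∃ j, A i j * B j k = maxMul A B i k :=
  exists_maxVec_eq A (fun j => B j k) i

lemma maxVec_maxMul {A : Fin n → Fin n → ℝ} (B : Fin n → Fin n → ℝ) {x : Fin n → ℝ}
    (hA : ∀ i j, 0 ≤ A i j) (hx : ∀ i, 0 ≤ x i) :
    maxVec (maxMul A B) x = maxVec A (maxVec B x) := by
  funext i
  apply le_antisymm
  · obtain ⟨k, hk⟩ := exists_maxVec_eq (maxMul A B) x i
    obtain ⟨j, hj⟩ := exists_maxMul_eq A B i k
    rw [← hk, ← hj, mul_assoc]
    exact (mul_le_mul_of_nonneg_left (le_maxVec B x j k) (hA i j)).trans (le_maxVec A _ i j)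
  · obtain ⟨j, hj⟩ := exists_maxVec_eq A (maxVec B x) i
    obtain ⟨k, hk⟩ := exists_maxVec_eq B x j
    rw [← hj, ← hk, ← mul_assoc]
    exact (mul_le_mul_of_nonneg_right (le_maxMul A B i j k) (hx k)).trans (le_maxVec _ x i k)

lemma maxVec_mono {A B : Fin n → Fin n → ℝ} {x y : Fin n → ℝ} (hA : ∀ i j, 0 ≤ A i j)
    (hAB : ∀ i j, A i j ≤ B i j) (hy : ∀ i, 0 ≤ y i) (hxy : ∀ i, x i ≤ y i) (i : Fin n) :
    maxVec A x i ≤ maxVec B y i := by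
  obtain ⟨j, hj⟩ := exists_maxVec_eq A x i
  rw [← hj]
  exact (mul_le_mul_of_nonneg_left (hxy j) (hA i j)).trans
    ((mul_le_mul_of_nonneg_right (hAB i j) (hy j)).trans (le_maxVec B y i j))

end Products

section Walks

variable {n : ℕ} {B : Fin n → Fin n → ℝ}

/-- The weight of the walk which starts at `i` and then visits the nodes of the list in turn. -/
noncomputable def walkWeight (B : Fin n → Fin n → ℝ) : Fin n → List (Fin n) → ℝ
  | _, [] => 1
  | i, a :: l => B i a * walkWeight B a l

lemma walkWeight_nonneg (hB : ∀ i j, 0 ≤ B i j) (i : Fin n) (l : List (Fin n)) :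
    0 ≤ walkWeight B i l := by
  induction l generalizing i with
  | nil => exact zero_le_one
  | cons a l ih => exact mul_nonneg (hB i a) (ih a)

lemma walkWeight_append_cons (i a : Fin n) (s t : List (Fin n)) :
    walkWeight B i (s ++ a :: t) = walkWeight B i (s ++ [a]) * walkWeight B a t := by
  induction s generalizing i with
  | nil => simp [walkWeight]
  | cons b s ih => simp [walkWeight, ih b, mul_assoc]

lemma walkWeight_div (A : Fin n → Fin n → ℝ) (c : ℝ) (i : Fin n) (l : List (Fin n)) :
    walkWeight (fun i j => A i j / c) i l = walkWeight A i l / c ^ l.length := by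
  induction l generalizing i with
  | nil => simp [walkWeight]
  | cons a l ih => simp [walkWeight, ih a, pow_succ', div_mul_div_comm]

lemma cycleProd_cons (x : Fin n) (s : List (Fin n)) :
    cycleProd B (x :: s) = walkWeight B x (s ++ [x]) := by
  have key (x y : Fin n) (s : List (Fin n)) :
      (((x :: s).zip (s ++ [y])).map fun p => B p.1 p.2).prod = walkWeight B x (s ++ [y]) := by
    induction s generalizing x with
    | nil => simp [walkWeight]
    | cons a s ih => simpa [walkWeight] using Or.inl (ih a)
  simpa [cycleProd] using key x x s

lemma cycleProd_rpow_le_mu (A : Fin n → Fin n → ℝ) {l : List (Fin n)} (hl : l ≠ [])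
    (hnd : l.Nodup) : cycleProd A l ^ ((l.length : ℝ)⁻¹) ≤ mu A := by
  refine le_csSup (Set.Finite.bddAbove ?_) ⟨l, hl, hnd, rfl⟩
  refine (Set.finite_range fun l : {l : List (Fin n) // l.Nodup} =>
    cycleProd A l.1 ^ ((l.1.length : ℝ)⁻¹)).subset ?_
  rintro _ ⟨l, -, hnd, rfl⟩
  exact ⟨⟨l, hnd⟩, rfl⟩

/-- After division by `mu A`, elementary cycles have weight at most one. -/
lemma walkWeight_cycle_div_mu_le_one {A : Fin n → Fin n → ℝ} (hA : ∀ i j, 0 ≤ A i j)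
    (hmu : 0 < mu A) (x : Fin n) (s : List (Fin n)) (hnd : (x :: s).Nodup) :
    walkWeight (fun i j => A i j / mu A) x (s ++ [x]) ≤ 1 := by
  have h := cycleProd_rpow_le_mu A (List.cons_ne_nil x s) hnd
  rw [walkWeight_div, div_le_one (pow_pos hmu _)]
  rw [cycleProd_cons, Real.rpow_inv_le_iff_of_pos (walkWeight_nonneg hA _ _) hmu.le
    (by simp; positivity), Real.rpow_natCast] at h
  simpa using h

/-- If elementary cycles have weight at most one, every walk is dominated by an elementary path
with the same endpoints. -/
lemma exists_nodup_walkWeight_le (hB : ∀ i j, 0 ≤ B i j)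
    (hcyc : ∀ x s, (x :: s).Nodup → walkWeight B x (s ++ [x]) ≤ 1) (i : Fin n)
    (l : List (Fin n)) :
    ∃ l', (i :: l').Nodup ∧ l'.getLastD i = l.getLastD i ∧
      walkWeight B i l ≤ walkWeight B i l' := by
  induction l generalizing i with
  | nil => exact ⟨[], by simp, rfl, le_rfl⟩
  | cons a l ih =>
    obtain ⟨l', hnd, hlast, hle⟩ := ih a
    have hle' : walkWeight B i (a :: l) ≤ walkWeight B i (a :: l') :=
      mul_le_mul_of_nonneg_left hle (hB i a)
    by_cases hi : i ∈ a :: l'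
    · obtain ⟨s, t, hst⟩ := List.append_of_mem hi
      have hlast' : (a :: l').getLastD i = t.getLastD i := by
        rw [hst]
        simp [List.getLastD_eq_getLast?, List.getLast?_append, List.getLast?_cons]
      rw [hst] at hle' hnd
      have hnd' := List.nodup_append.1 hnd
      refine ⟨t, hnd'.2.1, ?_, hle'.trans ?_⟩
      · rw [← hlast', List.getLastD_cons, List.getLastD_cons, hlast]
      · rw [walkWeight_append_cons]
        refine mul_le_of_le_one_left (walkWeight_nonneg hB _ _) (hcyc i s ?_)
        exact List.nodup_cons.2 ⟨fun h => hnd'.2.2 i h i (by simp) rfl, hnd'.1⟩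
    · exact ⟨a :: l', List.nodup_cons.2 ⟨hi, hnd⟩,
        by simpa only [List.getLastD_cons] using hlast, hle'⟩

lemma walkWeight_le_maxPow (hB : ∀ i j, 0 ≤ B i j) (i : Fin n) (l : List (Fin n)) :
    walkWeight B i l ≤ maxPow B l.length i (l.getLastD i) := by
  induction l generalizing i with
  | nil => simp [walkWeight, maxPow]
  | cons a l ih =>
    rw [List.getLastD_cons]
    exact (mul_le_mul_of_nonneg_left (ih a) (hB i a)).trans (le_maxMul B _ i a _)

lemma maxPow_eq_zero_or_walkWeight (p : ℕ) (i j : Fin n) :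
    maxPow B p i j = 0 ∨ ∃ l, l.getLastD i = j ∧ maxPow B p i j = walkWeight B i l := by
  induction p generalizing i with
  | zero =>
    by_cases h : i = j
    · exact Or.inr ⟨[], h, by simp [maxPow, walkWeight, h]⟩
    · simp [maxPow, h]
  | succ p ih =>
    obtain ⟨a, ha⟩ := exists_maxMul_eq B (maxPow B p) i j
    change B i a * maxPow B p a j = maxPow B (p + 1) i j at ha
    rw [← ha]
    rcases ih a with h | ⟨l, hl, h⟩
    · simp [h]
    · exact Or.inr ⟨a :: l, by simpa only [List.getLastD_cons] using hl, by rw [h]; rfl⟩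

end Walks

section KleeneStar

variable {n : ℕ} {B : Fin n → Fin n → ℝ}

lemma maxPow_le_kleeneStar (B : Fin n → Fin n → ℝ) {p : ℕ} (hp : p < n) (i j : Fin n) :
    maxPow B p i j ≤ kleeneStar B i j :=
  le_ciSup (f := fun p : Fin n => maxPow B p i j) (Set.finite_range _).bddAbove ⟨p, hp⟩

lemma exists_maxPow_eq_kleeneStar (B : Fin n → Fin n → ℝ) (i j : Fin n) :
    ∃ p, maxPow B p i j = kleeneStar B i j := by
  have : Nonempty (Fin n) := ⟨i⟩
  obtain ⟨p, hp⟩ := exists_eq_ciSup_of_finite (f := fun p : Fin n => maxPow B p i j)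
  exact ⟨p, hp⟩

lemma one_le_kleeneStar_self (B : Fin n → Fin n → ℝ) (i : Fin n) : 1 ≤ kleeneStar B i i := by
  simpa [maxPow] using maxPow_le_kleeneStar B i.pos i i

lemma kleeneStar_nonneg (B : Fin n → Fin n → ℝ) (i j : Fin n) : 0 ≤ kleeneStar B i j := by
  refine le_trans ?_ (maxPow_le_kleeneStar B i.pos i j)
  simp only [maxPow]
  split_ifs <;> norm_num

lemma mul_kleeneStar_le (hB : ∀ i j, 0 ≤ B i j)
    (hcyc : ∀ x s, (x :: s).Nodup → walkWeight B x (s ++ [x]) ≤ 1) (i a j : Fin n) :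
    B i a * kleeneStar B a j ≤ kleeneStar B i j := by
  obtain ⟨p, hp⟩ := exists_maxPow_eq_kleeneStar B a j
  rw [← hp]
  rcases maxPow_eq_zero_or_walkWeight (B := B) p a j with h | ⟨l, hl, h⟩
  · simpa [h] using kleeneStar_nonneg B i j
  · rw [h]
    obtain ⟨l', hnd, hlast, hle⟩ := exists_nodup_walkWeight_le hB hcyc i (a :: l)
    rw [List.getLastD_cons, hl] at hlast
    have hlen : l'.length < n := by simpa using hnd.length_le_card
    have hpow := walkWeight_le_maxPow hB i l'
    rw [hlast] at hpow
    exact hle.trans (hpow.trans (maxPow_le_kleeneStar B hlen i j))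

lemma le_kleeneStar (hB : ∀ i j, 0 ≤ B i j)
    (hcyc : ∀ x s, (x :: s).Nodup → walkWeight B x (s ++ [x]) ≤ 1) (i j : Fin n) :
    B i j ≤ kleeneStar B i j :=
  (le_mul_of_one_le_right (hB i j) (one_le_kleeneStar_self B j)).trans
    (mul_kleeneStar_le hB hcyc i j j)

lemma maxPow_mul_kleeneStar_le (hB : ∀ i j, 0 ≤ B i j)
    (hcyc : ∀ x s, (x :: s).Nodup → walkWeight B x (s ++ [x]) ≤ 1) (p : ℕ) (i a j : Fin n) :
    maxPow B p i a * kleeneStar B a j ≤ kleeneStar B i j := by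
  induction p generalizing i with
  | zero =>
    by_cases h : i = a
    · simp [maxPow, h]
    · simpa [maxPow, h] using kleeneStar_nonneg B i j
  | succ p ih =>
    obtain ⟨b, hb⟩ := exists_maxMul_eq B (maxPow B p) i a
    change B i b * maxPow B p b a = maxPow B (p + 1) i a at hb
    rw [← hb, mul_assoc]
    exact (mul_le_mul_of_nonneg_left (ih b) (hB i b)).trans (mul_kleeneStar_le hB hcyc i b j)

lemma maxMul_kleeneStar_self_le (hB : ∀ i j, 0 ≤ B i j)
    (hcyc : ∀ x s, (x :: s).Nodup → walkWeight B x (s ++ [x]) ≤ 1) (i j : Fin n) :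
    maxMul (kleeneStar B) (kleeneStar B) i j ≤ kleeneStar B i j := by
  obtain ⟨a, ha⟩ := exists_maxMul_eq (kleeneStar B) (kleeneStar B) i j
  obtain ⟨p, hp⟩ := exists_maxPow_eq_kleeneStar B i a
  rw [← ha, ← hp]
  exact maxPow_mul_kleeneStar_le hB hcyc p i a j

end KleeneStar

/-- Finitely many commuting reflexive and transitive nonnegative matrices have a common positive
subeigenvector for the value one. -/
lemma exists_pos_maxVec_le_of_commute {n : ℕ} {ι : Type*} (S : ι → Fin n → Fin n → ℝ)
    (hS : ∀ k i j, 0 ≤ S k i j) (hrefl : ∀ k i, 1 ≤ S k i i)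
    (htrans : ∀ k i j, maxMul (S k) (S k) i j ≤ S k i j)
    (hcomm : ∀ k l, maxMul (S k) (S l) = maxMul (S l) (S k)) (L : List ι) :
    ∃ x : Fin n → ℝ, (∀ i, 0 < x i) ∧ ∀ k ∈ L, ∀ i, maxVec (S k) x i ≤ x i := by
  induction L with
  | nil => exact ⟨fun _ => 1, fun _ => one_pos, by simp⟩
  | cons l L ih =>
    obtain ⟨x, hx, hle⟩ := ih
    have hx' i := (hx i).le
    have hpos i : 0 < maxVec (S l) x i :=
      (mul_pos (one_pos.trans_le (hrefl l i)) (hx i)).trans_le (le_maxVec (S l) x i i)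
    refine ⟨maxVec (S l) x, hpos, fun k hk i => ?_⟩
    rw [← maxVec_maxMul _ (hS k) hx']
    rcases List.mem_cons.1 hk with rfl | hk
    · refine maxVec_mono (fun i j => ?_) (htrans k) hx' (fun _ => le_rfl) i
      exact (mul_nonneg (hS k i i) (hS k i j)).trans (le_maxMul _ _ i i j)
    · rw [hcomm, maxVec_maxMul _ (hS l) hx']
      exact maxVec_mono (hS l) (fun _ _ => le_rfl) hx' (hle k hk) i

/-- if the Kleene stars of the normalised matrices commute pairwise, then
there is a common positive subeigenvector. -/
theorem stmt10 {n m : ℕ} (hm : 0 < m) (A : Fin m → Fin n → Fin n → ℝ)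
    (hA : ∀ k i j, 0 ≤ A k i j) (hirr : ∀ k, Irred (A k)) (hmu : ∀ k, 0 < mu (A k))
    (hcomm : ∀ k l,
      maxMul (kleeneStar fun i j => A k i j / mu (A k))
          (kleeneStar fun i j => A l i j / mu (A l)) =
        maxMul (kleeneStar fun i j => A l i j / mu (A l))
          (kleeneStar fun i j => A k i j / mu (A k))) :
    ∃ x : Fin n → ℝ, (∀ i, 0 < x i) ∧ ∀ k i, maxVec (A k) x i ≤ mu (A k) * x i := by
  have hB k i j : 0 ≤ A k i j / mu (A k) := div_nonneg (hA k i j) (hmu k).le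
  have hcyc k := walkWeight_cycle_div_mu_le_one (hA k) (hmu k)
  obtain ⟨x, hx, hle⟩ := exists_pos_maxVec_le_of_commute
    (fun k => kleeneStar fun i j => A k i j / mu (A k))
    (fun k => kleeneStar_nonneg _) (fun k => one_le_kleeneStar_self _)
    (fun k => maxMul_kleeneStar_self_le (hB k) (hcyc k)) hcomm (List.finRange m)
  refine ⟨x, hx, fun k i => ?_⟩
  obtain ⟨j, hj⟩ := exists_maxVec_eq (A k) x i
  rw [← hj, ← div_le_iff₀' (hmu k), ← div_mul_eq_mul_div]
  exact (mul_le_mul_of_nonneg_right (le_kleeneStar (hB k) (hcyc k) i j) (hx j).le).trans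
    ((le_maxVec _ x i j).trans (hle k (List.mem_finRange k) i))

end MaxAlg
end

section
/- Let A and B be 3×3 SR-matrices, and let Ŝ = Â ⊕ B̂ be the entrywise maximum of Â = A/μ(A) and B̂ = B/μ(B). The following are equivalent: (i) μ(Ŝ) = 1; (ii) A and B commute with respect to the max-algebraic matrix product, A⊗B = B⊗A; (iii) there exists a positive vector x ∈ int(ℝ³_+) with A⊗x ≤ μ(A)·x and B⊗x ≤ μ(B)·x. -/
open Filter Relation

namespace MaxAlg

theorem bddAbove_cycleMeans {n : ℕ} (M : Fin n → Fin n → ℝ) :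
    BddAbove {c | ∃ l : List (Fin n), l ≠ [] ∧ l.Nodup ∧
      c = cycleProd M l ^ ((l.length : ℝ)⁻¹)} := by
  refine Set.Finite.bddAbove ?_
  have hfin : {l : List (Fin n) | l.Nodup}.Finite :=
    Set.finite_coe_iff.1 (Finite.of_fintype {l : List (Fin n) // l.Nodup})
  refine (hfin.image fun l => cycleProd M l ^ ((l.length : ℝ)⁻¹)).subset ?_
  rintro c ⟨l, -, hl, rfl⟩
  exact ⟨l, hl, rfl⟩

theorem cycleMean_le_mu {n : ℕ} (M : Fin n → Fin n → ℝ) {l : List (Fin n)} (hne : l ≠ [])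
    (hl : l.Nodup) : cycleProd M l ^ ((l.length : ℝ)⁻¹) ≤ mu M :=
  le_csSup (bddAbove_cycleMeans M) ⟨l, hne, hl, rfl⟩

theorem le_mu_of_pow_le {n : ℕ} {M : Fin n → Fin n → ℝ} {r : ℝ} (hr : 0 ≤ r)
    {l : List (Fin n)} (hne : l ≠ []) (hl : l.Nodup) (h : r ^ l.length ≤ cycleProd M l) :
    r ≤ mu M := by
  refine le_trans ?_ (cycleMean_le_mu M hne hl)
  rw [← Real.pow_rpow_inv_natCast hr (List.length_pos_of_ne_nil hne).ne']
  exact Real.rpow_le_rpow (by positivity) h (by positivity)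

theorem cycleProd_nonneg {n : ℕ} {M : Fin n → Fin n → ℝ} (hM : ∀ i j, 0 ≤ M i j)
    (l : List (Fin n)) : 0 ≤ cycleProd M l := by
  refine List.prod_nonneg ?_
  intro a ha
  obtain ⟨p, -, rfl⟩ := List.mem_map.1 ha
  exact hM _ _

theorem cycleProd_le_one {n : ℕ} {M : Fin n → Fin n → ℝ} (hmu : mu M ≤ 1)
    {l : List (Fin n)} (hne : l ≠ []) (hl : l.Nodup) : cycleProd M l ≤ 1 := by
  by_contra! h
  have hpos : (0 : ℝ) < (l.length : ℝ)⁻¹ := by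
    have := List.length_pos_of_ne_nil hne
    positivity
  exact absurd ((cycleMean_le_mu M hne hl).trans hmu) (not_le.2 (Real.one_lt_rpow h hpos))

theorem prod_zip_le {n : ℕ} {M : Fin n → Fin n → ℝ} (hM : ∀ i j, 0 ≤ M i j) {r : ℝ}
    {x : Fin n → ℝ} (hx : ∀ i, 0 < x i) (h : ∀ i j, M i j * x j ≤ r * x i) :
    ∀ l l' : List (Fin n), l.length = l'.length →
      ((l.zip l').map fun p => M p.1 p.2).prod * (l'.map x).prod ≤
        r ^ l.length * (l.map x).prod
  | [], [], _ => by simp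
  | a :: l, b :: l', hlen => by
    have ih := prod_zip_le hM hx h l l' (by simpa using hlen)
    have hl' : 0 ≤ ((l.zip l').map fun p => M p.1 p.2).prod * (l'.map x).prod := by
      refine mul_nonneg (List.prod_nonneg ?_) (List.prod_nonneg ?_)
      · intro c hc
        obtain ⟨p, -, rfl⟩ := List.mem_map.1 hc
        exact hM _ _
      · intro c hc
        obtain ⟨p, -, rfl⟩ := List.mem_map.1 hc
        exact (hx _).le
    have hmul := mul_le_mul (h a b) ih hl'
      ((mul_nonneg (hM a b) (hx b).le).trans (h a b))
    simp only [List.zip_cons_cons, List.map_cons, List.prod_cons, List.length_cons, pow_succ]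
    linarith

theorem mu_le_of_subeigenvector {n : ℕ} [NeZero n] {M : Fin n → Fin n → ℝ}
    (hM : ∀ i j, 0 ≤ M i j) {r : ℝ} (hr : 0 ≤ r) {x : Fin n → ℝ} (hx : ∀ i, 0 < x i)
    (h : ∀ i j, M i j * x j ≤ r * x i) : mu M ≤ r := by
  refine csSup_le ⟨_, [0], by simp, by simp, rfl⟩ ?_
  rintro c ⟨l, hne, -, rfl⟩
  have hz := prod_zip_le hM hx h l (l.rotate 1) (by simp)
  have hperm : ((l.rotate 1).map x).prod = (l.map x).prod :=
    ((l.rotate_perm 1).map x).prod_eq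
  have hpos : 0 < (l.map x).prod := by
    refine List.prod_pos ?_
    intro c hc
    obtain ⟨p, -, rfl⟩ := List.mem_map.1 hc
    exact hx _
  rw [hperm] at hz
  have hle : cycleProd M l ≤ r ^ l.length := le_of_mul_le_mul_right hz hpos
  rw [← Real.pow_rpow_inv_natCast hr (List.length_pos_of_ne_nil hne).ne']
  exact Real.rpow_le_rpow (cycleProd_nonneg hM l) hle (by positivity)

theorem iSup_fin_three (f : Fin 3 → ℝ) (i : Fin 3) :
    ⨆ j, f j = max (f i) (max (f (i + 1)) (f (i + 2))) := by
  have hb : BddAbove (Set.range f) := (Set.finite_range f).bddAbove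
  refine le_antisymm (ciSup_le fun j => ?_)
    (max_le (le_ciSup hb _) (max_le (le_ciSup hb _) (le_ciSup hb _)))
  have hj : j = i ∨ j = i + 1 ∨ j = i + 2 := by decide +revert
  rcases hj with rfl | rfl | rfl <;> simp

theorem add_two_add_one (i : Fin 3) : i + 2 + 1 = i := by decide +revert

theorem add_one_add_one (i : Fin 3) : i + 1 + 1 = i + 2 := by decide +revert

/-- The `3 × 3` circulant SR-matrix with entry `s` on the edges `i → i + 1`. -/
noncomputable def circ (s : ℝ) (i j : Fin 3) : ℝ :=
  if j - i = 0 then 1 else if j - i = 1 then s else s⁻¹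

@[simp] theorem circ_self (s : ℝ) (i : Fin 3) : circ s i i = 1 := by simp [circ]

@[simp] theorem circ_forward (s : ℝ) (i : Fin 3) : circ s i (i + 1) = s := by simp [circ]

@[simp] theorem circ_backward (s : ℝ) (i : Fin 3) : circ s (i + 1) i = s⁻¹ := by
  have h₀ : i - (i + 1) ≠ 0 := by decide +revert
  have h₁ : i - (i + 1) ≠ 1 := by decide +revert
  rw [circ, if_neg h₀, if_neg h₁]

theorem circ_pos {s : ℝ} (hs : 0 < s) (i j : Fin 3) : 0 < circ s i j := by
  unfold circ
  split_ifs <;> positivity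

theorem circ_le {s : ℝ} (hs : 0 < s) (i j : Fin 3) : circ s i j ≤ max s s⁻¹ := by
  unfold circ
  split_ifs
  · rcases le_total 1 s with h | h
    · exact le_max_of_le_left h
    · exact le_max_of_le_right ((one_le_inv₀ hs).2 h)
  · exact le_max_left _ _
  · exact le_max_right _ _

theorem maxMul_circ_comm (s t : ℝ) : maxMul (circ s) (circ t) = maxMul (circ t) (circ s) := by
  funext i k
  refine Equiv.iSup_congr (Equiv.subLeft (i + k)) fun j => ?_
  have h₁ : i + k - j - i = k - j := by abel
  have h₂ : k - (i + k - j) = j - i := by abel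
  simp only [Equiv.subLeft_apply, circ, h₁, h₂, mul_comm]

/-- The diagonal conjugate `circ s i j * x i / x j` of the matrix `circ s`. -/
noncomputable def conjCirc (s : ℝ) (x : Fin 3 → ℝ) (i j : Fin 3) : ℝ :=
  circ s i j * x i / x j

theorem IsSR.exists_eq_conjCirc {A : Fin 3 → Fin 3 → ℝ} (hA : IsSR A) :
    ∃ s : ℝ, 0 < s ∧ ∃ x : Fin 3 → ℝ, (∀ i, 0 < x i) ∧ A = conjCirc s x := by
  obtain ⟨hpos, hdiag, hrec⟩ := hA
  have ha := hpos 0 1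
  have hb := hpos 1 2
  have hc := hpos 2 0
  have ha' : A 1 0 = (A 0 1)⁻¹ := eq_inv_of_mul_eq_one_left (hrec 1 0 (by decide))
  have hb' : A 2 1 = (A 1 2)⁻¹ := eq_inv_of_mul_eq_one_left (hrec 2 1 (by decide))
  have hc' : A 0 2 = (A 2 0)⁻¹ := eq_inv_of_mul_eq_one_left (hrec 0 2 (by decide))
  obtain ⟨s, hs, hs3⟩ : ∃ s : ℝ, 0 < s ∧ s ^ 3 = A 0 1 * A 1 2 * A 2 0 :=
    ⟨(A 0 1 * A 1 2 * A 2 0) ^ (((3 : ℕ) : ℝ)⁻¹), by positivity,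
      Real.rpow_inv_natCast_pow (by positivity) (by norm_num)⟩
  refine ⟨s, hs, ![1, s / A 0 1, s ^ 2 / (A 0 1 * A 1 2)], ?_, ?_⟩
  · intro i
    fin_cases i <;> simp <;> positivity
  · have hc3 : A 2 0 = s ^ 3 / (A 0 1 * A 1 2) := by rw [hs3]; field_simp
    funext i j
    have h₁ : (-1 : Fin 3) ≠ 1 := by decide
    have h₂ : (-2 : Fin 3) = 1 := by decide
    fin_cases i <;> fin_cases j <;>
      simp [conjCirc, circ, h₁, h₂, hdiag, ha', hb', hc', hc3] <;> field_simp

section conjCirc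

variable {s t : ℝ} {x y : Fin 3 → ℝ}

theorem conjCirc_pos (hs : 0 < s) (hx : ∀ i, 0 < x i) (i j : Fin 3) : 0 < conjCirc s x i j :=
  div_pos (mul_pos (circ_pos hs i j) (hx i)) (hx j)

theorem conjCirc_mul_le (hs : 0 < s) (hx : ∀ i, 0 < x i) (i j : Fin 3) :
    conjCirc s x i j * x j ≤ max s s⁻¹ * x i := by
  rw [conjCirc, div_mul_cancel₀ _ (hx j).ne']
  exact mul_le_mul_of_nonneg_right (circ_le hs i j) (hx i).le

theorem mu_conjCirc (hs : 0 < s) (hx : ∀ i, 0 < x i) : mu (conjCirc s x) = max s s⁻¹ := by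
  have h0 := (hx 0).ne'
  have h1 := (hx 1).ne'
  have h2 := (hx 2).ne'
  have hm₁ : (-1 : Fin 3) ≠ 1 := by decide
  have hm₂ : (-2 : Fin 3) = 1 := by decide
  refine le_antisymm (mu_le_of_subeigenvector (fun i j => (conjCirc_pos hs hx i j).le)
    (by positivity) hx (conjCirc_mul_le hs hx)) (max_le ?_ ?_)
  · refine le_mu_of_pow_le hs.le (l := [0, 1, 2]) (by simp) (by decide) (le_of_eq ?_)
    simp [cycleProd, conjCirc, circ, hm₂]
    field_simp
  · refine le_mu_of_pow_le (by positivity) (l := [0, 2, 1]) (by simp) (by decide) (le_of_eq ?_)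
    simp [cycleProd, conjCirc, circ, hm₁]
    field_simp

theorem conjCirc_div_mu_forward (hs : 1 ≤ s) (hx : ∀ i, 0 < x i) (i : Fin 3) :
    conjCirc s x i (i + 1) / mu (conjCirc s x) = x i / x (i + 1) := by
  have hs0 : 0 < s := by linarith
  have := (hx (i + 1)).ne'
  rw [mu_conjCirc hs0 hx, max_eq_left ((inv_le_one_of_one_le₀ hs).trans hs)]
  simp only [conjCirc, circ_forward]
  field_simp

theorem conjCirc_div_mu_backward (hs0 : 0 < s) (hs : s ≤ 1) (hx : ∀ i, 0 < x i) (i : Fin 3) :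
    conjCirc s x (i + 1) i / mu (conjCirc s x) = x (i + 1) / x i := by
  have := (hx i).ne'
  rw [mu_conjCirc hs0 hx, max_eq_right (hs.trans ((one_le_inv₀ hs0).2 hs))]
  simp only [conjCirc, circ_backward]
  field_simp

theorem conjCirc_congr (hx : ∀ i, 0 < x i) (hy : ∀ i, 0 < y i)
    (h : ∀ i j, x i * y j = x j * y i) : conjCirc s y = conjCirc s x := by
  funext i j
  have := (hx j).ne'
  have := (hy j).ne'
  rw [conjCirc, conjCirc, div_eq_div_iff (by assumption) (by assumption)]
  linear_combination (-circ s i j) * h i j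

theorem maxMul_conjCirc (hx : ∀ i, 0 < x i) (i k : Fin 3) :
    maxMul (conjCirc s x) (conjCirc t x) i k = maxMul (circ s) (circ t) i k * (x i / x k) := by
  unfold maxMul
  rw [Real.iSup_mul_of_nonneg (div_pos (hx i) (hx k)).le]
  refine iSup_congr fun j => ?_
  have := (hx j).ne'
  have := (hx k).ne'
  unfold conjCirc
  field_simp

end conjCirc

theorem eq_of_max_inv_eq {p r : ℝ} (hp : 0 < p) (hr : 0 < r)
    (h : max 1 (max p⁻¹ r) = max 1 (max p r⁻¹)) : p = r := by
  have hpp := mul_inv_cancel₀ hp.ne'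
  have hrr := mul_inv_cancel₀ hr.ne'
  rcases le_total 1 p with h1 | h1 <;> rcases le_total 1 r with h2 | h2
  · have := inv_le_one_of_one_le₀ h1
    have := inv_le_one_of_one_le₀ h2
    grind
  · have := inv_le_one_of_one_le₀ h1
    have := (one_le_inv₀ hr).2 h2
    grind
  · have := (one_le_inv₀ hp).2 h1
    have := inv_le_one_of_one_le₀ h2
    grind
  · have := (one_le_inv₀ hp).2 h1
    have := (one_le_inv₀ hr).2 h2
    have : p⁻¹ = r⁻¹ := by grind
    exact inv_injective this

theorem proportional_of_ratio_le {x y : Fin 3 → ℝ} (hy : ∀ i, 0 < y i)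
    (h : ∀ i, x (i + 1) / y (i + 1) ≤ x i / y i) : ∀ i j, x i * y j = x j * y i := by
  have h0 : x 1 / y 1 ≤ x 0 / y 0 := h 0
  have h1 : x 2 / y 2 ≤ x 1 / y 1 := h 1
  have h2 : x 0 / y 0 ≤ x 2 / y 2 := h 2
  intro i j
  rw [← div_eq_div_iff (hy i).ne' (hy j).ne']
  fin_cases i <;> fin_cases j <;> simp <;> linarith

theorem proportional_of_maxMul_comm {s t : ℝ} (hs : 0 < s) (ht : 0 < t) {x y : Fin 3 → ℝ}
    (hx : ∀ i, 0 < x i) (hy : ∀ i, 0 < y i)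
    (h : maxMul (conjCirc s x) (conjCirc t y) = maxMul (conjCirc t y) (conjCirc s x)) :
    ∀ i j, x i * y j = x j * y i := by
  set p : Fin 3 → ℝ := fun i => t / s * (y i / x i) * (x (i + 1) / y (i + 1)) with hp
  have hppos : ∀ i, 0 < p i := fun i =>
    mul_pos (mul_pos (div_pos ht hs) (div_pos (hy i) (hx i))) (div_pos (hx _) (hy _))
  have hstep : ∀ i, p i = p (i + 2) := by
    intro i
    refine eq_of_max_inv_eq (hppos i) (hppos (i + 2)) ?_
    have hi := congrFun (congrFun h i) i
    simp only [maxMul] at hi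
    rw [iSup_fin_three _ i, iSup_fin_three _ i] at hi
    have h3 : i + 2 + 1 = i := add_two_add_one i
    have hf (s : ℝ) : circ s (i + 2) i = s := by simpa only [h3] using circ_forward s (i + 2)
    have hb (s : ℝ) : circ s i (i + 2) = s⁻¹ := by simpa only [h3] using circ_backward s (i + 2)
    have hx0 := (hx i).ne'
    have hx1 := (hx (i + 1)).ne'
    have hx2 := (hx (i + 2)).ne'
    have hy0 := (hy i).ne'
    have hy1 := (hy (i + 1)).ne'
    have hy2 := (hy (i + 2)).ne'
    simp only [conjCirc, circ_self, circ_forward, circ_backward, hf, hb] at hi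
    simp only [hp, h3]
    convert hi using 3 <;> field_simp
  have h0 : p 0 = p 2 := hstep 0
  have h1 : p 1 = p 0 := hstep 1
  have hx0 := hx 0
  have hx1 := hx 1
  have hx2 := hx 2
  have hy0 := hy 0
  have hy1 := hy 1
  have hy2 := hy 2
  set a := x 0 / y 0 with ha
  set b := x 1 / y 1 with hb
  set c := x 2 / y 2 with hc
  have ha0 : 0 < a := div_pos hx0 hy0
  have hb0 : 0 < b := div_pos hx1 hy1
  have hc0 : 0 < c := div_pos hx2 hy2
  have hp0 : p 0 = t / s * (b / a) := by
    change t / s * (y 0 / x 0) * (x 1 / y 1) = _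
    rw [ha, hb]; field_simp
  have hp1 : p 1 = t / s * (c / b) := by
    change t / s * (y 1 / x 1) * (x 2 / y 2) = _
    rw [hb, hc]; field_simp
  have hp2 : p 2 = t / s * (a / c) := by
    change t / s * (y 2 / x 2) * (x 0 / y 0) = _
    rw [ha, hc]; field_simp
  rw [hp0, hp2] at h0
  rw [hp0, hp1] at h1
  have hts : t / s ≠ 0 := (div_pos ht hs).ne'
  have h0' := mul_left_cancel₀ hts h0
  have h1' := mul_left_cancel₀ hts h1
  rw [div_eq_div_iff ha0.ne' hc0.ne'] at h0'
  rw [div_eq_div_iff hb0.ne' ha0.ne'] at h1'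
  have hab : a = b := by
    have h3 : a ^ 3 = b ^ 3 := by linear_combination b * h1' - a * h0'
    exact (pow_left_inj₀ ha0.le hb0.le (by norm_num)).1 h3
  have hbc : c = b := by
    rw [hab] at h1'
    exact mul_right_cancel₀ hb0.ne' h1'
  refine proportional_of_ratio_le hy fun i => ?_
  fin_cases i
  · exact hab.ge
  · exact hbc.le
  · exact (hab.trans hbc.symm).le

/-- The entrywise maximum `Â ⊕ B̂` of the normalised matrices. -/
noncomputable def normSup (A B : Fin 3 → Fin 3 → ℝ) (i j : Fin 3) : ℝ :=
  max (A i j / mu A) (B i j / mu B)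

theorem normSup_comm (A B : Fin 3 → Fin 3 → ℝ) : normSup A B = normSup B A := by
  funext i j
  exact max_comm _ _

section normSup

variable {s t : ℝ} {x y : Fin 3 → ℝ}

theorem normSup_nonneg (hs : 0 < s) (hx : ∀ i, 0 < x i) (B : Fin 3 → Fin 3 → ℝ) (i j : Fin 3) :
    0 ≤ normSup (conjCirc s x) B i j := by
  refine le_max_of_le_left (div_nonneg (conjCirc_pos hs hx i j).le ?_)
  rw [mu_conjCirc hs hx]
  positivity

theorem le_normSup_forward (hs : 1 ≤ s) (hx : ∀ i, 0 < x i) (B : Fin 3 → Fin 3 → ℝ)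
    (i : Fin 3) : x i / x (i + 1) ≤ normSup (conjCirc s x) B i (i + 1) :=
  (conjCirc_div_mu_forward hs hx i).ge.trans (le_max_left _ _)

theorem le_normSup_backward (hs0 : 0 < s) (hs : s ≤ 1) (hx : ∀ i, 0 < x i)
    (B : Fin 3 → Fin 3 → ℝ) (i : Fin 3) :
    x (i + 1) / x i ≤ normSup (conjCirc s x) B (i + 1) i :=
  (conjCirc_div_mu_backward hs0 hs hx i).ge.trans (le_max_left _ _)

theorem one_le_mu_normSup (hs : 0 < s) (hx : ∀ i, 0 < x i) (B : Fin 3 → Fin 3 → ℝ) :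
    1 ≤ mu (normSup (conjCirc s x) B) := by
  have hnn := normSup_nonneg hs hx B
  have h0 := hx 0
  have h1 := hx 1
  have h2 := hx 2
  rcases le_total 1 s with h | h
  · refine le_mu_of_pow_le zero_le_one (l := [0, 1, 2]) (by simp) (by decide) ?_
    have e0 : x 0 / x 1 ≤ _ := le_normSup_forward h hx B 0
    have e1 : x 1 / x 2 ≤ _ := le_normSup_forward h hx B 1
    have e2 : x 2 / x 0 ≤ _ := le_normSup_forward h hx B 2
    calc (1 : ℝ) ^ 3 = x 0 / x 1 * (x 1 / x 2 * (x 2 / x 0)) := by field_simp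
      _ ≤ normSup (conjCirc s x) B 0 1 *
          (normSup (conjCirc s x) B 1 2 * normSup (conjCirc s x) B 2 0) :=
        mul_le_mul e0 (mul_le_mul e1 e2 (by positivity) (hnn _ _)) (by positivity) (hnn _ _)
      _ = _ := by simp [cycleProd]
  · refine le_mu_of_pow_le zero_le_one (l := [1, 0, 2]) (by simp) (by decide) ?_
    have e0 : x 1 / x 0 ≤ _ := le_normSup_backward hs h hx B 0
    have e1 : x 2 / x 1 ≤ _ := le_normSup_backward hs h hx B 1
    have e2 : x 0 / x 2 ≤ _ := le_normSup_backward hs h hx B 2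
    calc (1 : ℝ) ^ 3 = x 1 / x 0 * (x 0 / x 2 * (x 2 / x 1)) := by field_simp
      _ ≤ normSup (conjCirc s x) B 1 0 *
          (normSup (conjCirc s x) B 0 2 * normSup (conjCirc s x) B 2 1) :=
        mul_le_mul e0 (mul_le_mul e2 e1 (by positivity) (hnn _ _)) (by positivity) (hnn _ _)
      _ = _ := by simp [cycleProd]

theorem mu_normSup_le_one {A B : Fin 3 → Fin 3 → ℝ} (hnn : ∀ i j, 0 ≤ normSup A B i j)
    (hA : 0 < mu A) (hB : 0 < mu B) {z : Fin 3 → ℝ} (hz : ∀ i, 0 < z i)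
    (h₁ : ∀ i, maxVec A z i ≤ mu A * z i) (h₂ : ∀ i, maxVec B z i ≤ mu B * z i) :
    mu (normSup A B) ≤ 1 := by
  refine mu_le_of_subeigenvector hnn zero_le_one hz fun i j => ?_
  have key {M : Fin 3 → Fin 3 → ℝ} (hM : 0 < mu M) (h : maxVec M z i ≤ mu M * z i) :
      M i j / mu M * z j ≤ 1 * z i := by
    have hb : BddAbove (Set.range fun j => M i j * z j) := (Set.finite_range _).bddAbove
    have hj : M i j * z j ≤ mu M * z i := (le_ciSup hb j).trans h
    rw [one_mul, div_mul_eq_mul_div, div_le_iff₀ hM]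
    linarith
  rw [normSup, max_mul_of_nonneg _ _ (hz j).le]
  exact max_le (key hA (h₁ i)) (key hB (h₂ i))

theorem two_cycle_le_one {M : Fin 3 → Fin 3 → ℝ} (h : mu M ≤ 1) (i : Fin 3) :
    M i (i + 1) * M (i + 1) i ≤ 1 := by
  have hnd : [i, i + 1].Nodup := by clear h; decide +revert
  simpa [cycleProd] using cycleProd_le_one h (by simp) hnd

theorem forward_cycle_le_one {M : Fin 3 → Fin 3 → ℝ} (h : mu M ≤ 1) (i : Fin 3) :
    M i (i + 1) * (M (i + 1) (i + 2) * M (i + 2) i) ≤ 1 := by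
  have hnd : [i, i + 1, i + 2].Nodup := by clear h; decide +revert
  simpa [cycleProd] using cycleProd_le_one h (by simp) hnd

theorem backward_cycle_le_one {M : Fin 3 → Fin 3 → ℝ} (h : mu M ≤ 1) (i : Fin 3) :
    M (i + 1) i * (M i (i + 2) * M (i + 2) (i + 1)) ≤ 1 := by
  have hnd : [i + 1, i, i + 2].Nodup := by clear h; decide +revert
  simpa [cycleProd] using cycleProd_le_one h (by simp) hnd

theorem ratio_le_of_mul_le_one {a b c d : ℝ} (hb : 0 < b) (hc : 0 < c) (hd : 0 < d)
    (h : a / b * (c / d) ≤ 1) : a / d ≤ b / c := by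
  rw [div_mul_div_comm, div_le_one (by positivity)] at h
  rwa [div_le_div_iff₀ hd hc]

theorem proportional_of_forward_backward (hs : 1 ≤ s) (ht0 : 0 < t) (ht : t ≤ 1)
    (hx : ∀ i, 0 < x i) (hy : ∀ i, 0 < y i)
    (h : mu (normSup (conjCirc s x) (conjCirc t y)) ≤ 1) : ∀ i j, x i * y j = x j * y i := by
  have hnn := normSup_nonneg (one_pos.trans_le hs) hx (conjCirc t y)
  have hyx : ∀ i j, y i * x j = y j * x i := by
    refine proportional_of_ratio_le hx fun i =>
      ratio_le_of_mul_le_one (hy i) (hx i) (hx (i + 1)) ?_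
    have e1 := le_normSup_forward hs hx (conjCirc t y) i
    have e2 := le_normSup_backward ht0 ht hy (conjCirc s x) i
    rw [normSup_comm] at e2
    rw [mul_comm]
    exact (mul_le_mul e1 e2 (div_pos (hy _) (hy _)).le (hnn _ _)).trans
      (two_cycle_le_one h i)
  intro i j
  linear_combination hyx j i

theorem proportional_of_mu_normSup_le_one (hs : 0 < s) (ht : 0 < t)
    (hx : ∀ i, 0 < x i) (hy : ∀ i, 0 < y i)
    (h : mu (normSup (conjCirc s x) (conjCirc t y)) ≤ 1) : ∀ i j, x i * y j = x j * y i := by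
  have hnn := normSup_nonneg hs hx (conjCirc t y)
  have hpx : ∀ i j, 0 < x i / x j := fun i j => div_pos (hx i) (hx j)
  have hpy : ∀ i j, 0 < y i / y j := fun i j => div_pos (hy i) (hy j)
  rcases le_total 1 s with hs1 | hs1 <;> rcases le_total 1 t with ht1 | ht1
  · refine proportional_of_ratio_le hy fun i =>
      ratio_le_of_mul_le_one (hx i) (hy i) (hy (i + 1)) ?_
    have e0 := le_normSup_forward ht1 hy (conjCirc s x) i
    rw [normSup_comm] at e0
    have e1 := le_normSup_forward hs1 hx (conjCirc t y) (i + 1)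
    have e2 := le_normSup_forward hs1 hx (conjCirc t y) (i + 2)
    rw [add_one_add_one] at e1
    rw [add_two_add_one] at e2
    have hmul : x (i + 1) / x (i + 2) * (x (i + 2) / x i) = x (i + 1) / x i :=
      div_mul_div_cancel₀ (hx _).ne'
    rw [mul_comm, ← hmul]
    exact (mul_le_mul e0 (mul_le_mul e1 e2 (hpx _ _).le (hnn _ _))
      (mul_pos (hpx _ _) (hpx _ _)).le (hnn _ _)).trans (forward_cycle_le_one h i)
  · exact proportional_of_forward_backward hs1 ht ht1 hx hy h
  · rw [normSup_comm] at h
    intro i j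
    linear_combination proportional_of_forward_backward ht1 hs hs1 hy hx h j i
  · refine proportional_of_ratio_le hy fun i =>
      ratio_le_of_mul_le_one (hx i) (hy i) (hy (i + 1)) ?_
    have e0 := le_normSup_backward hs hs1 hx (conjCirc t y) i
    have e1 := le_normSup_backward ht ht1 hy (conjCirc s x) (i + 1)
    have e2 := le_normSup_backward ht ht1 hy (conjCirc s x) (i + 2)
    rw [normSup_comm, add_one_add_one] at e1
    rw [normSup_comm, add_two_add_one] at e2
    have hmul : y i / y (i + 2) * (y (i + 2) / y (i + 1)) = y i / y (i + 1) :=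
      div_mul_div_cancel₀ (hy _).ne'
    rw [← hmul]
    exact (mul_le_mul e0 (mul_le_mul e2 e1 (hpy _ _).le (hnn _ _))
      (mul_pos (hpy _ _) (hpy _ _)).le (hnn _ _)).trans (backward_cycle_le_one h i)

end normSup

theorem maxVec_conjCirc_le {s : ℝ} {x : Fin 3 → ℝ} (hs : 0 < s) (hx : ∀ i, 0 < x i)
    (i : Fin 3) : maxVec (conjCirc s x) x i ≤ mu (conjCirc s x) * x i := by
  rw [mu_conjCirc hs hx]
  exact ciSup_le fun j => conjCirc_mul_le hs hx i j

/-- for `3 × 3` SR-matrices `A`, `B` with `Ŝ = Â ⊕ B̂`, the following are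
equivalent: (i) `μ(Ŝ) = 1`; (ii) `A ⊗ B = B ⊗ A`; (iii) `A` and `B` have a common
positive subeigenvector. -/
theorem stmt12 (A B : Fin 3 → Fin 3 → ℝ) (hA : IsSR A) (hB : IsSR B) :
    List.TFAE [
      mu (fun i j => max (A i j / mu A) (B i j / mu B)) = 1,
      maxMul A B = maxMul B A,
      ∃ x : Fin 3 → ℝ, (∀ i, 0 < x i) ∧
        (∀ i, maxVec A x i ≤ mu A * x i) ∧ (∀ i, maxVec B x i ≤ mu B * x i)
    ] := by
  obtain ⟨s, hs, x, hx, rfl⟩ := hA.exists_eq_conjCirc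
  obtain ⟨t, ht, y, hy, rfl⟩ := hB.exists_eq_conjCirc
  change List.TFAE [mu (normSup (conjCirc s x) (conjCirc t y)) = 1, _, _]
  tfae_have 1 → 2 := by
    intro h
    rw [conjCirc_congr hx hy (proportional_of_mu_normSup_le_one hs ht hx hy h.le)]
    funext i k
    rw [maxMul_conjCirc hx, maxMul_conjCirc hx, maxMul_circ_comm]
  tfae_have 2 → 3 := by
    intro h
    rw [conjCirc_congr hx hy (proportional_of_maxMul_comm hs ht hx hy h)]
    exact ⟨x, hx, maxVec_conjCirc_le hs hx, maxVec_conjCirc_le ht hx⟩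
  tfae_have 3 → 1 := by
    rintro ⟨z, hz, h₁, h₂⟩
    refine le_antisymm (mu_normSup_le_one (normSup_nonneg hs hx _) ?_ ?_ hz h₁ h₂)
      (one_le_mu_normSup hs hx _)
    · rw [mu_conjCirc hs hx]
      positivity
    · rw [mu_conjCirc ht hy]
      positivity
  tfae_finish

end MaxAlg
end
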